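/- Let Y : Ω → ℝ be square-integrable with respect to the product probability measure μ and suppose Var_μ(Y) > 0. Then for every i ∈ N the total sensitivity index satisfies 0 ≤ S_i^T ≤ 1, and moreover Σ_{i=1}^M S_i^T ≥ 1. -/

import Mathlib

open MeasureTheory

/-- The marginal `A_J Y`: integrate out the coordinates not in `J`,
i.e. `(A_J Y)(x) = ∫ Y(z) dμ_{N∖J}(z)` with `z_i = x_i` for `i ∈ J`. -/
noncomputable def margA {M : ℕ} {Ω : Fin M → Type*} [∀ i, MeasurableSpace (Ω i)]
    (μ : ∀ i, Measure (Ω i)) (J : Finset (Fin M)) (Y : (∀ i, Ω i) → ℝ) :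
    (∀ i, Ω i) → ℝ :=
  fun x => ∫ z, Y (fun i => if i ∈ J then x i else z i) ∂(Measure.pi μ)

/-- The ANOVA projection `P_I Y`, defined recursively by
`P_I Y = A_I Y - ∑_{J ⊊ I} P_J Y` (so that `P_∅ Y = 𝔼_μ[Y]`). -/
noncomputable def anovaP {M : ℕ} {Ω : Fin M → Type*} [∀ i, MeasurableSpace (Ω i)]
    (μ : ∀ i, Measure (Ω i)) (Y : (∀ i, Ω i) → ℝ) (I : Finset (Fin M)) :
    (∀ i, Ω i) → ℝ :=
  margA μ I Y - ∑ J ∈ I.ssubsets.attach, anovaP μ Y J.1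
termination_by I.card
decreasing_by exact Finset.card_lt_card (Finset.mem_ssubsets.mp J.2)
open ProbabilityTheory

section Helpers

variable {M : ℕ} {Ω : Fin M → Type*} [∀ i, MeasurableSpace (Ω i)]

/-- Mix two points: coordinates in `S` from `x`, the others from `z`. -/
def mixc (S : Finset (Fin M)) (x z : ∀ i, Ω i) : ∀ i, Ω i :=
  fun i => if i ∈ S then x i else z i

lemma measurable_mixc (S : Finset (Fin M)) :
    Measurable (fun p : (∀ i, Ω i) × (∀ i, Ω i) => mixc S p.1 p.2) := by
  refine measurable_pi_lambda _ fun i => ?_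
  by_cases h : i ∈ S
  · simp only [mixc, h, if_true]; fun_prop
  · simp only [mixc, h, if_false]; fun_prop

variable (μ : ∀ i, Measure (Ω i)) [∀ i, IsProbabilityMeasure (μ i)]

lemma mp_swap (S : Finset (Fin M)) :
    MeasurePreserving (fun p : (∀ i, Ω i) × (∀ i, Ω i) => (mixc S p.1 p.2, mixc S p.2 p.1))
      ((Measure.pi μ).prod (Measure.pi μ)) ((Measure.pi μ).prod (Measure.pi μ)) := by
  have hm : Measurable
      (fun p : (∀ i, Ω i) × (∀ i, Ω i) => (mixc S p.1 p.2, mixc S p.2 p.1)) :=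
    (measurable_mixc S).prodMk ((measurable_mixc S).comp measurable_swap)
  refine ⟨hm, ?_⟩
  symm
  have h3 := Measure.FiniteSpanningSetsIn.pi (μ := μ)
    (fun i => (μ i).toFiniteSpanningSetsIn)
  refine Measure.prod_eq_generateFrom generateFrom_pi generateFrom_pi isPiSystem_pi
    isPiSystem_pi h3 h3 ?_
  rintro _ ⟨s, hs, rfl⟩ _ ⟨t, ht, rfl⟩
  have hs' : ∀ i, MeasurableSet (s i) := fun i => hs i (Set.mem_univ i)
  have ht' : ∀ i, MeasurableSet (t i) := fun i => ht i (Set.mem_univ i)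
  rw [Measure.map_apply hm
    ((MeasurableSet.univ_pi hs').prod (MeasurableSet.univ_pi ht'))]
  have : (fun p : (∀ i, Ω i) × (∀ i, Ω i) => (mixc S p.1 p.2, mixc S p.2 p.1)) ⁻¹'
      ((Set.univ.pi s) ×ˢ (Set.univ.pi t)) =
      (Set.univ.pi fun i => if i ∈ S then s i else t i) ×ˢ
      (Set.univ.pi fun i => if i ∈ S then t i else s i) := by
    ext p
    simp only [Set.mem_preimage, Set.mem_prod, Set.mem_univ_pi, mixc, ← forall_and]
    refine forall_congr' fun i => ?_
    by_cases h : i ∈ S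
    · simp [h]
    · simp [h, and_comm]
  rw [this, Measure.prod_prod, Measure.pi_pi, Measure.pi_pi, Measure.pi_pi, Measure.pi_pi,
    ← Finset.prod_mul_distrib, ← Finset.prod_mul_distrib]
  refine Finset.prod_congr rfl fun i _ => ?_
  by_cases h : i ∈ S
  · simp [h]
  · simp [h, mul_comm]

/-- Three independent copies. -/
noncomputable abbrev tri : Measure ((∀ i, Ω i) × (∀ i, Ω i) × (∀ i, Ω i)) :=
  (Measure.pi μ).prod ((Measure.pi μ).prod (Measure.pi μ))

lemma mp_mixc (S : Finset (Fin M)) :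
    MeasurePreserving (fun p : (∀ i, Ω i) × (∀ i, Ω i) => mixc S p.1 p.2)
      ((Measure.pi μ).prod (Measure.pi μ)) (Measure.pi μ) :=
  measurePreserving_fst.comp (mp_swap μ S)

lemma mp_first (S : Finset (Fin M)) :
    MeasurePreserving (fun p : (∀ i, Ω i) × (∀ i, Ω i) × (∀ i, Ω i) => mixc S p.1 p.2.1)
      (tri μ) (Measure.pi μ) :=
  (mp_mixc μ S).comp ((MeasurePreserving.id _).prod measurePreserving_fst)

lemma mp_second (S : Finset (Fin M)) :
    MeasurePreserving (fun p : (∀ i, Ω i) × (∀ i, Ω i) × (∀ i, Ω i) => mixc S p.1 p.2.2)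
      (tri μ) (Measure.pi μ) :=
  (mp_mixc μ S).comp ((MeasurePreserving.id _).prod measurePreserving_snd)

lemma mp_T1 (S : Finset (Fin M)) :
    MeasurePreserving (fun p : (∀ i, Ω i) × (∀ i, Ω i) × (∀ i, Ω i) =>
      (mixc S p.1 p.2.1, mixc S p.2.1 p.1, p.2.2)) (tri μ) (tri μ) :=
  (measurePreserving_prodAssoc _ _ _).comp
    (((mp_swap μ S).prod (MeasurePreserving.id (Measure.pi μ))).comp
      ((measurePreserving_prodAssoc _ _ _).symm))

lemma mp_T2 (S : Finset (Fin M)) :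
    MeasurePreserving (fun p : (∀ i, Ω i) × (∀ i, Ω i) × (∀ i, Ω i) =>
      (mixc S p.1 p.2.2, p.2.1, mixc S p.2.2 p.1)) (tri μ) (tri μ) :=
  ((MeasurePreserving.id (Measure.pi μ)).prod Measure.measurePreserving_swap).comp
    ((mp_T1 μ S).comp
      ((MeasurePreserving.id (Measure.pi μ)).prod Measure.measurePreserving_swap))

variable {μ} {Y : (∀ i, Ω i) → ℝ}

lemma integrable_F (hY : MemLp Y 2 (Measure.pi μ)) (J K : Finset (Fin M)) :
    Integrable (fun p : (∀ i, Ω i) × (∀ i, Ω i) × (∀ i, Ω i) =>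
      Y (mixc J p.1 p.2.1) * Y (mixc K p.1 p.2.2)) (tri μ) :=
  MemLp.integrable_mul (p := 2) (q := 2) (hY.comp_measurePreserving (mp_first μ J))
    (hY.comp_measurePreserving (mp_second μ K))

lemma margA_mul (J K : Finset (Fin M)) (x : ∀ i, Ω i) :
    margA μ J Y x * margA μ K Y x =
      ∫ q, Y (mixc J x q.1) * Y (mixc K x q.2) ∂((Measure.pi μ).prod (Measure.pi μ)) :=
  (integral_prod_mul (fun z => Y (mixc J x z)) (fun z => Y (mixc K x z))).symm

lemma margA_memLp (hY : MemLp Y 2 (Measure.pi μ)) (J : Finset (Fin M)) :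
    MemLp (margA μ J Y) 2 (Measure.pi μ) := by
  have h1 : AEStronglyMeasurable (margA μ J Y) (Measure.pi μ) :=
    (hY.comp_measurePreserving (mp_mixc μ J)).aestronglyMeasurable.integral_prod_right'
  rw [memLp_two_iff_integrable_sq h1]
  simp only [pow_two, margA_mul]
  exact (integrable_F hY J J).integral_prod_left

lemma integral_margA_mul (hY : MemLp Y 2 (Measure.pi μ)) (J K : Finset (Fin M)) :
    ∫ x, margA μ J Y x * margA μ K Y x ∂(Measure.pi μ) =
      ∫ p, Y (mixc J p.1 p.2.1) * Y (mixc K p.1 p.2.2) ∂(tri μ) := by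
  simp only [margA_mul]
  exact (integral_prod _ (integrable_F hY J K)).symm

lemma integral_margA_mul_inter (hY : MemLp Y 2 (Measure.pi μ)) (J K : Finset (Fin M)) :
    ∫ x, margA μ J Y x * margA μ K Y x ∂(Measure.pi μ) =
      ∫ x, margA μ (J ∩ K) Y x * margA μ (J ∩ K) Y x ∂(Measure.pi μ) := by
  rw [integral_margA_mul hY, integral_margA_mul hY]
  have hT := (mp_T2 μ (K \ J)ᶜ).comp (mp_T1 μ (J \ K)ᶜ)
  have hF := (integrable_F hY (J ∩ K) (J ∩ K)).aestronglyMeasurable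
  rw [← hT.map_eq] at hF
  rw [← hT.map_eq, integral_map hT.measurable.aemeasurable hF, hT.map_eq]
  refine integral_congr_ae (ae_of_all _ fun p => ?_)
  simp only [Function.comp]
  congr 2
  · ext i
    by_cases h1 : i ∈ J <;> by_cases h2 : i ∈ K <;> simp [mixc, h1, h2]
  · ext i
    by_cases h1 : i ∈ J <;> by_cases h2 : i ∈ K <;> simp [mixc, h1, h2]

lemma anovaP_eq (I : Finset (Fin M)) :
    anovaP μ Y I = margA μ I Y - ∑ J ∈ I.ssubsets, anovaP μ Y J := by
  rw [anovaP, Finset.sum_attach I.ssubsets (fun J => anovaP μ Y J)]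

lemma sum_anovaP (I : Finset (Fin M)) :
    ∑ J ∈ I.powerset, anovaP μ Y J = margA μ I Y := by
  have h : I.powerset = insert I I.ssubsets := by
    ext J; simp [Finset.mem_ssubsets, le_iff_eq_or_lt]
  rw [h, Finset.sum_insert (by simp), anovaP_eq I]
  abel

lemma anovaP_memLp (hY : MemLp Y 2 (Measure.pi μ)) (I : Finset (Fin M)) :
    MemLp (anovaP μ Y I) 2 (Measure.pi μ) := by
  induction I using Finset.strongInduction with
  | H I ih =>
    rw [anovaP_eq]
    refine (margA_memLp hY I).sub (memLp_finsetSum' _ fun J hJ => ih J ?_)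
    exact Finset.mem_ssubsets.mp hJ

lemma integral_sum_mul (s : Finset (Finset (Fin M))) {f : Finset (Fin M) → (∀ i, Ω i) → ℝ}
    {g : (∀ i, Ω i) → ℝ} (hf : ∀ J, MemLp (f J) 2 (Measure.pi μ))
    (hg : MemLp g 2 (Measure.pi μ)) :
    ∫ x, (∑ J ∈ s, f J) x * g x ∂(Measure.pi μ) =
      ∑ J ∈ s, ∫ x, f J x * g x ∂(Measure.pi μ) := by
  simp only [Finset.sum_apply, Finset.sum_mul]
  exact integral_finsetSum _ fun J _ => MemLp.integrable_mul (p := 2) (q := 2) (hf J) hg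

lemma integral_anovaP_mul (hY : MemLp Y 2 (Measure.pi μ)) (I : Finset (Fin M))
    {g : (∀ i, Ω i) → ℝ} (hg : MemLp g 2 (Measure.pi μ)) :
    ∫ x, anovaP μ Y I x * g x ∂(Measure.pi μ) =
      ∫ x, margA μ I Y x * g x ∂(Measure.pi μ) -
        ∑ J ∈ I.ssubsets, ∫ x, anovaP μ Y J x * g x ∂(Measure.pi μ) := by
  rw [← integral_sum_mul _ (anovaP_memLp hY) hg, anovaP_eq I]
  simp only [Pi.sub_apply, sub_mul]
  exact integral_sub (MemLp.integrable_mul (p := 2) (q := 2) (margA_memLp hY I) hg)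
    (MemLp.integrable_mul (p := 2) (q := 2)
      (memLp_finsetSum' _ fun J _ => anovaP_memLp hY J) hg)

lemma anovaP_margA (hY : MemLp Y 2 (Measure.pi μ)) (K I : Finset (Fin M)) (hIK : ¬ I ⊆ K) :
    ∫ x, anovaP μ Y I x * margA μ K Y x ∂(Measure.pi μ) = 0 := by
  induction I using Finset.strongInduction with
  | H I ih =>
    rw [integral_anovaP_mul hY I (margA_memLp hY K)]
    have hsub : (I ∩ K).powerset ⊆ I.ssubsets := by
      intro J hJ
      rw [Finset.mem_powerset, Finset.subset_inter_iff] at hJ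
      rw [Finset.mem_ssubsets]
      exact ⟨hJ.1, fun h => hIK (h.trans hJ.2)⟩
    rw [← Finset.sum_subset hsub, ← integral_sum_mul _ (anovaP_memLp hY) (margA_memLp hY K),
      sum_anovaP, integral_margA_mul_inter hY I K, integral_margA_mul_inter hY (I ∩ K) K]
    · simp
    · intro J hJ hJ'
      rw [Finset.mem_ssubsets] at hJ
      refine ih J hJ fun h => hJ' ?_
      rw [Finset.mem_powerset]
      exact Finset.subset_inter hJ.1 h

lemma anovaP_orth_aux (hY : MemLp Y 2 (Measure.pi μ)) (I K : Finset (Fin M)) (hIK : ¬ I ⊆ K) :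
    ∫ x, anovaP μ Y K x * anovaP μ Y I x ∂(Measure.pi μ) = 0 := by
  induction K using Finset.strongInduction with
  | H K ih =>
    rw [integral_anovaP_mul hY K (anovaP_memLp hY I), Finset.sum_eq_zero]
    · simp only [mul_comm (margA μ K Y _)]
      rw [anovaP_margA hY K I hIK, sub_zero]
    · intro J hJ
      rw [Finset.mem_ssubsets] at hJ
      exact ih J hJ fun h => hIK (h.trans hJ.1)

lemma anovaP_orth (hY : MemLp Y 2 (Measure.pi μ)) (I K : Finset (Fin M)) (hIK : I ≠ K) :
    ∫ x, anovaP μ Y K x * anovaP μ Y I x ∂(Measure.pi μ) = 0 := by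
  by_cases h : I ⊆ K
  · simp only [mul_comm (anovaP μ Y K _)]
    exact anovaP_orth_aux hY K I fun h' => hIK (h.antisymm h')
  · exact anovaP_orth_aux hY I K h

lemma variance_decomp (hY : MemLp Y 2 (Measure.pi μ)) :
    variance Y (Measure.pi μ) =
      ∑ I ∈ (Finset.univ : Finset (Finset (Fin M))).erase ∅,
        ∫ x, (anovaP μ Y I x) ^ 2 ∂(Measure.pi μ) := by
  have hN : ∑ J, anovaP μ Y J = Y := by
    rw [← Finset.powerset_univ, sum_anovaP]
    ext x; simp [margA]
  have h0 : anovaP μ Y ∅ = fun _ => ∫ x, Y x ∂(Measure.pi μ) := by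
    have he : (∅ : Finset (Fin M)).ssubsets = ∅ := by
      ext J; simp [Finset.mem_ssubsets]
    rw [anovaP_eq, he]
    ext x; simp [margA]
  have h2 : ∫ x, Y x * Y x ∂(Measure.pi μ) =
      ∑ I, ∫ x, (anovaP μ Y I x) ^ 2 ∂(Measure.pi μ) := by
    calc ∫ x, Y x * Y x ∂(Measure.pi μ)
        = ∫ x, (∑ J, anovaP μ Y J) x * Y x ∂(Measure.pi μ) := by rw [hN]
      _ = ∑ J, ∫ x, anovaP μ Y J x * Y x ∂(Measure.pi μ) :=
          integral_sum_mul _ (anovaP_memLp hY) hY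
      _ = _ := by
          refine Finset.sum_congr rfl fun J _ => ?_
          calc ∫ x, anovaP μ Y J x * Y x ∂(Measure.pi μ)
              = ∫ x, (∑ K, anovaP μ Y K) x * anovaP μ Y J x ∂(Measure.pi μ) := by
                rw [hN]; simp only [mul_comm]
            _ = ∑ K, ∫ x, anovaP μ Y K x * anovaP μ Y J x ∂(Measure.pi μ) :=
                integral_sum_mul _ (anovaP_memLp hY) (anovaP_memLp hY J)
            _ = _ := by
                rw [Finset.sum_eq_single J]
                · simp only [pow_two]
                · intro K _ hK
                  exact anovaP_orth hY J K hK.symm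
                · simp
  rw [variance_eq_sub hY, ← Finset.add_sum_erase _ _ (Finset.mem_univ ∅)] at *
  simp only [Pi.pow_apply, pow_two] at *
  rw [h2, h0]
  simp

end Helpers


/-- **Bounds on total sensitivity indices.** If `Y` is square-integrable w.r.t. the
product probability measure and `Var(Y) > 0`, then for every `i ∈ N` the total
sensitivity index `Sᵢᵀ = ∑_{I ⊆ N, i ∈ I} σ²_I(Y)/σ²(Y)` satisfies `0 ≤ Sᵢᵀ ≤ 1`,
and moreover `∑_{i=1}^M Sᵢᵀ ≥ 1`. -/
theorem total_sensitivity_indices_bounds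
    {M : ℕ} (hM : 1 ≤ M) {Ω : Fin M → Type*} [∀ i, MeasurableSpace (Ω i)]
    (μ : ∀ i, Measure (Ω i)) [∀ i, IsProbabilityMeasure (μ i)]
    (Y : (∀ i, Ω i) → ℝ) (hY : MemLp Y 2 (Measure.pi μ))
    (hvar : 0 < variance Y (Measure.pi μ)) :
    (∀ i : Fin M,
        0 ≤ ∑ I ∈ (Finset.univ : Finset (Fin M)).powerset.filter (fun I => i ∈ I),
              (∫ x, (anovaP μ Y I x) ^ 2 ∂(Measure.pi μ)) / variance Y (Measure.pi μ)
      ∧ ∑ I ∈ (Finset.univ : Finset (Fin M)).powerset.filter (fun I => i ∈ I),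
              (∫ x, (anovaP μ Y I x) ^ 2 ∂(Measure.pi μ)) / variance Y (Measure.pi μ)
          ≤ 1)
    ∧ 1 ≤ ∑ i : Fin M,
            ∑ I ∈ (Finset.univ : Finset (Fin M)).powerset.filter (fun I => i ∈ I),
              (∫ x, (anovaP μ Y I x) ^ 2 ∂(Measure.pi μ)) / variance Y (Measure.pi μ) := by
  have hdec := variance_decomp hY
  have hnn : ∀ I, 0 ≤ ∫ x, (anovaP μ Y I x) ^ 2 ∂(Measure.pi μ) :=
    fun I => integral_nonneg fun x => sq_nonneg _
  refine ⟨fun i => ⟨Finset.sum_nonneg fun I _ => div_nonneg (hnn I) hvar.le, ?_⟩, ?_⟩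
  · rw [← Finset.sum_div, div_le_one hvar, hdec]
    refine Finset.sum_le_sum_of_subset_of_nonneg ?_ fun I _ _ => hnn I
    intro I hI
    simp only [Finset.mem_filter] at hI
    exact Finset.mem_erase.mpr ⟨Finset.ne_empty_of_mem hI.2, Finset.mem_univ _⟩
  · simp only [← Finset.sum_div]
    rw [one_le_div hvar]
    conv_lhs => rw [hdec]
    simp only [Finset.sum_filter]
    rw [Finset.sum_comm, Finset.powerset_univ]
    refine (Finset.sum_le_sum fun I hI => ?_).trans
      (Finset.sum_le_sum_of_subset_of_nonneg (Finset.erase_subset ∅ _) fun I _ _ =>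
        Finset.sum_nonneg fun i _ => ?_)
    · obtain ⟨i, hi⟩ := Finset.nonempty_iff_ne_empty.mpr (Finset.mem_erase.mp hI).1
      refine le_trans ?_ (Finset.single_le_sum (fun j _ => ?_) (Finset.mem_univ i))
      · rw [if_pos hi]
      · split_ifs
        exacts [hnn I, le_rfl]
    · split_ifs
      exacts [hnn I, le_rfl]
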